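/- arXiv:1207.0389 — 4 statements merged into one kernel-verified Lean document; each statement's English description precedes it below -/
import Mathlib

section
/- Let 1 ≤ m ≤ d be integers, let a_1, …, a_m be pairwise distinct nonzero real numbers, let E ⊆ ℝ be a Borel set and s ∈ ℂ. Assume that Z^{E,s}_{d} ≠ 0, that Z^{E,s}_{d−j+1} ≠ 0 for every 1 ≤ j ≤ m, that Z_d(a_1,…,a_m) ≠ 0, that Z_{d−j+1}(a_k) ≠ 0 for all 1 ≤ j,k ≤ m, and that det[Γ_{d−j}(a_k)]_{j,k=1}^{m} ≠ 0. Then 𝔈̄_d(a_1,…,a_m; E; s) = det[ Γ_{d−j}(a_k) · 𝔈̄_{d−j+1}(a_k; E; s) ]_{j,k=1}^{m} / det[ Γ_{d−j}(a_k) ]_{j,k=1}^{m}. -/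
open MeasureTheory
open scoped BigOperators

/-- The Vandermonde product `Δ(λ) = ∏_{i<j} (λ_j − λ_i)`. -/
def vandermondeProd {d : ℕ} (l : Fin d → ℝ) : ℝ :=
  ∏ p ∈ Finset.univ.filter (fun p : Fin d × Fin d => p.1 < p.2), (l p.2 - l p.1)

/-- The pairs `(j,k)` with `0 ≤ j < k < m`. -/
def pairsBelow (m : ℕ) : Finset (ℕ × ℕ) :=
  (Finset.range m ×ˢ Finset.range m).filter (fun p => p.1 < p.2)

/-- The normalized partition function `Z_d(a_0,…,a_{m−1})` of the Hermitian matrix model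
with external source eigenvalues `(a_0,…,a_{m−1},0,…,0)` and (complex-valued) weight `V`:
`Z_d(a) = [∏_{i=0}^{d−m−1} i! · ∏_{j<k<m} (a_k − a_j) · ∏_{k<m} a_k^{d−m}]⁻¹
  ∫_{ℝ^d} det B(λ) Δ(λ) ∏ V(λ_i) dλ`,
where `B(λ)_{i,k} = λ_k^i` for `i < d−m` and `B(λ)_{i,k} = e^{a_{i−(d−m)} λ_k}` otherwise. -/
noncomputable def ZpartC (V : ℝ → ℂ) (d m : ℕ) (a : ℕ → ℝ) : ℂ :=
  ((∏ i ∈ Finset.range (d - m), (Nat.factorial i : ℂ)) *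
      (∏ p ∈ pairsBelow m, ((a p.2 : ℂ) - (a p.1 : ℂ))) *
      ∏ k ∈ Finset.range m, (a k : ℂ) ^ (d - m))⁻¹ *
    ∫ l : Fin d → ℝ,
      (Matrix.of fun i k : Fin d =>
          if (i : ℕ) < d - m then (l k : ℂ) ^ (i : ℕ)
          else Complex.exp ((a ((i : ℕ) - (d - m)) : ℂ) * l k)).det *
        (vandermondeProd l : ℂ) * ∏ i : Fin d, V (l i)

/-- The real weight `W` regarded as a complex weight. -/
noncomputable def weightC (W : ℝ → ℝ) : ℝ → ℂ := fun x => (W x : ℂ)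

/-- The deformed complex weight `W_{E,s}(x) = W(x)(1 − s·χ_E(x))`. -/
noncomputable def weightEs (W : ℝ → ℝ) (E : Set ℝ) (s : ℂ) : ℝ → ℂ :=
  fun x => (W x : ℂ) * (1 - s * E.indicator (fun _ => (1 : ℂ)) x)

/-- `𝔈_d(a_0,…,a_{m−1}; E; s) = Z^{E,s}_d(a_0,…,a_{m−1}) / Z_d(a_0,…,a_{m−1})`,
the expectation of `∏_j (1 − s·χ_E(λ_j))` over the eigenvalues of the external
source model. -/
noncomputable def Efrak (W : ℝ → ℝ) (E : Set ℝ) (s : ℂ) (d m : ℕ) (a : ℕ → ℝ) : ℂ :=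
  ZpartC (weightEs W E s) d m a / ZpartC (weightC W) d m a

/-- `𝔈̄_d(a; E; s) = 𝔈_d(a; E; s) / 𝔈_d(E; s)`. -/
noncomputable def Ebar (W : ℝ → ℝ) (E : Set ℝ) (s : ℂ) (d m : ℕ) (a : ℕ → ℝ) : ℂ :=
  Efrak W E s d m a / Efrak W E s d 0 a

/-- `Γ_j(a) = ∫ p_j(x) e^{ax} W(x) dx`, where `p_j` is the `j`-th orthonormal polynomial. -/
noncomputable def GammaW (W : ℝ → ℝ) (P : ℕ → Polynomial ℝ) (j : ℕ) (a : ℝ) : ℝ :=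
  ∫ x : ℝ, (P j).eval x * Real.exp (a * x) * W x

/-- The `n × n` matrix whose first `n - m` rows come from `A` and whose last `m` rows come
from `B`. -/
def stackedMatrix {R : Type*} (A B : ℕ → ℕ → R) (n m : ℕ) : Matrix (Fin n) (Fin n) R :=
  Matrix.of fun i j => if (i : ℕ) < n - m then A i j else B ((i : ℕ) - (n - m)) j

/-- The cofactors of the last row of `stackedMatrix A B (n + 1) 1`, extended by zero. -/
def lastRowCofactor {R : Type*} [CommRing R] (A : ℕ → ℕ → R) (n j : ℕ) : R :=
  if h : j < n + 1 then
    (-1) ^ (n + j) * (Matrix.of fun i k : Fin n => A i ((⟨j, h⟩ : Fin (n + 1)).succAbove k)).det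
  else 0

section Algebra

variable {R : Type*} [CommRing R]

theorem map_det_stackedMatrix {S : Type*} [CommRing S] (f : R →+* S) (A B : ℕ → ℕ → R)
    (n m : ℕ) :
    f (stackedMatrix A B n m).det =
      (stackedMatrix (fun i j => f (A i j)) (fun i j => f (B i j)) n m).det := by
  rw [RingHom.map_det]
  congr 1
  ext i j
  simp only [stackedMatrix, RingHom.mapMatrix_apply, Matrix.map_apply, Matrix.of_apply]
  split_ifs <;> rfl

theorem det_stackedMatrix_zero (A B : ℕ → ℕ → R) (n : ℕ) :
    (stackedMatrix A B n 0).det = (Matrix.of fun i j : Fin n => A i j).det := by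
  congr 1
  ext i j
  simp [stackedMatrix]

theorem lastRowCofactor_self (A B : ℕ → ℕ → R) (n : ℕ) :
    lastRowCofactor A n n = (stackedMatrix A B n 0).det := by
  rw [det_stackedMatrix_zero, lastRowCofactor, dif_pos (Nat.lt_succ_self n), ← two_mul, pow_mul]
  simp only [neg_one_sq, one_pow, one_mul]
  congr 1
  ext i j
  have : (⟨n, Nat.lt_succ_self n⟩ : Fin (n + 1)) = Fin.last n := rfl
  simp [this]

theorem det_stackedMatrix_one_eq_sum (A : ℕ → ℕ → R) (r : ℕ → R) (n N : ℕ) (hN : n + 1 ≤ N) :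
    (stackedMatrix A (fun _ => r) (n + 1) 1).det =
      ∑ j : Fin N, r j * lastRowCofactor A n j := by
  rw [Fin.sum_univ_eq_sum_range (fun j => r j * lastRowCofactor A n j) N,
    ← Finset.sum_subset (Finset.range_mono hN), ← Fin.sum_univ_eq_sum_range,
    Matrix.det_succ_row _ (Fin.last n)]
  · refine Finset.sum_congr rfl fun j _ => ?_
    have h : (stackedMatrix A (fun _ => r) (n + 1) 1).submatrix (Fin.last n).succAbove
        j.succAbove = Matrix.of fun i k : Fin n => A i (j.succAbove k) := by
      ext i k
      simp [stackedMatrix]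
    rw [h, lastRowCofactor, dif_pos j.2]
    simp only [stackedMatrix, Matrix.of_apply, Fin.val_last, Nat.add_sub_cancel, lt_irrefl,
      if_false]
    ring
  · intro j _ hj
    rw [lastRowCofactor, dif_neg (by simpa using hj), mul_zero]

theorem det_stackedMatrix_one_eq_zero (A : ℕ → ℕ → R) (n i : ℕ) (hi : i < n) :
    (stackedMatrix A (fun _ => A i) (n + 1) 1).det = 0 := by
  refine Matrix.det_zero_of_row_eq (i := ⟨i, by omega⟩) (j := Fin.last n) ?_ ?_
  · intro h
    have := congrArg Fin.val h
    simp at this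
    omega
  · ext j
    simp [stackedMatrix, hi]

theorem det_stackedMatrix_mul_prod (A B : ℕ → ℕ → R) (p m : ℕ) :
    (stackedMatrix A B (p + m) m).det * ∏ l : Fin m, (stackedMatrix A B (p + l) 0).det =
      (stackedMatrix A B p 0).det *
        (Matrix.of fun l k : Fin m =>
          (stackedMatrix A (fun _ => B k) (p + l + 1) 1).det).det := by
  set U : Matrix (Fin (p + m)) (Fin (p + m)) R := Matrix.of fun j n =>
    if (n : ℕ) < p then (if j = n then 1 else 0) else lastRowCofactor A n j with hU
  have hUdet : U.det = ∏ l : Fin m, (stackedMatrix A B (p + l) 0).det := by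
    rw [Matrix.det_of_isUpperTriangular, Fin.prod_univ_add]
    · simp [hU, lastRowCofactor_self A B]
    · intro i j hij
      have hij' : (j : ℕ) < i := hij
      simp only [hU, Matrix.of_apply]
      split_ifs with h1 h2
      · omega
      · rfl
      · rw [lastRowCofactor, dif_neg (by omega)]
  rw [← hUdet, ← Matrix.det_mul, ← Matrix.det_submatrix_equiv_self finSumFinEquiv,
    ← Matrix.det_transpose (Matrix.of _), det_stackedMatrix_zero]
  rw [← Matrix.det_fromBlocks_zero₁₂ _ (Matrix.of fun (k : Fin m) (n : Fin p) => B k n)]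
  congr 1
  ext i n
  rw [Matrix.submatrix_apply, Matrix.mul_apply]
  rcases n with n | n
  · have : ∀ j : Fin (p + m), U j (finSumFinEquiv (Sum.inl n)) =
        if j = Fin.castAdd m n then 1 else 0 := fun j => by simp [hU]
    simp only [this, mul_ite, mul_one, mul_zero, Finset.sum_ite_eq', Finset.mem_univ, if_true]
    rcases i with i | i <;> simp [stackedMatrix]
  · have : ∀ j : Fin (p + m), U j (finSumFinEquiv (Sum.inr n)) =
        lastRowCofactor A (p + n) j := fun j => by simp [hU]
    simp only [this]
    rcases i with i | i
    · simp only [stackedMatrix, Matrix.of_apply, Matrix.fromBlocks_apply₁₂, finSumFinEquiv_apply_left,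
        Fin.val_castAdd, Nat.add_sub_cancel, i.2, if_true, Matrix.zero_apply]
      rw [← det_stackedMatrix_one_eq_sum A (A i) _ _ (by omega)]
      exact det_stackedMatrix_one_eq_zero A _ _ (by omega)
    · simp only [stackedMatrix, Matrix.of_apply, Matrix.fromBlocks_apply₂₂,
        finSumFinEquiv_apply_right, Matrix.transpose_apply,
        Fin.val_natAdd, Nat.add_sub_cancel, Nat.add_sub_cancel_left,
        if_neg (Nat.not_lt.2 (Nat.le_add_right p i))]
      rw [← det_stackedMatrix_one_eq_sum A (B i) _ _ (by omega)]
      rfl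

/-- A Sylvester-type determinant identity, valid without any nonvanishing assumption. -/
theorem det_stackedMatrix_mul_prod_succ {K : Type*} [Field K] (A B : ℕ → ℕ → K) (p m : ℕ) :
    (stackedMatrix A B (p + (m + 1)) (m + 1)).det *
        ∏ l : Fin m, (stackedMatrix A B (p + l + 1) 0).det =
      (Matrix.of fun l k : Fin (m + 1) =>
        (stackedMatrix A (fun _ => B k) (p + l + 1) 1).det).det := by
  let A' : ℕ → ℕ → Polynomial K := fun i j =>
    Polynomial.C (A i j) + if i = j then Polynomial.X else 0
  let B' : ℕ → ℕ → Polynomial K := fun i j => Polynomial.C (B i j)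
  have hne : (stackedMatrix A' B' p 0).det ≠ 0 := by
    have h := Polynomial.leadingCoeff_det_X_one_add_C (Matrix.of fun i j : Fin p => A i j)
    have h2 : (stackedMatrix A' B' p 0).det = ((Polynomial.X : Polynomial K) •
        (1 : Matrix (Fin p) (Fin p) (Polynomial K)) +
          (Matrix.of fun i j : Fin p => A i j).map Polynomial.C).det := by
      rw [det_stackedMatrix_zero]
      congr 1
      ext1 i j
      simp [A', Matrix.one_apply, Fin.ext_iff, add_comm]
    intro h0
    rw [← h2, h0] at h
    simp at h
  have key := det_stackedMatrix_mul_prod A' B' p (m + 1)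
  rw [Fin.prod_univ_succ] at key
  simp only [Fin.val_zero, Fin.val_succ] at key
  rw [mul_left_comm] at key
  have key₂ := congrArg (Polynomial.evalRingHom (0 : K)) (mul_left_cancel₀ hne key)
  simp only [map_mul, map_prod, map_det_stackedMatrix] at key₂
  have hA : (fun i j => Polynomial.evalRingHom (0 : K) (A' i j)) = A := by
    ext i j
    by_cases h : i = j <;> simp [A', h]
  have hB : (fun i j => Polynomial.evalRingHom (0 : K) (B' i j)) = B := by
    ext i j
    simp [B']
  have hmat : (Polynomial.evalRingHom (0 : K)).mapMatrix (Matrix.of fun l k : Fin (m + 1) =>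
        (stackedMatrix A' (fun _ => B' k) (p + l + 1) 1).det) = Matrix.of fun l k : Fin (m + 1) =>
        (stackedMatrix A (fun _ => B k) (p + l + 1) 1).det := by
    ext l k
    simp only [RingHom.mapMatrix_apply, Matrix.map_apply, Matrix.of_apply, map_det_stackedMatrix,
      hA]
    congr 2
    ext i j
    simp [B']
  rw [RingHom.map_det, hmat, hA, hB] at key₂
  exact key₂

theorem det_stackedMatrix_zero_mul_sq (A B L : ℕ → ℕ → R) (hL : ∀ i j, i < j → L i j = 0)
    (hA : ∀ N i k, i < N → k < N →
      ∑ a : Fin N, (∑ b : Fin N, L i b * A b a) * L k a = if i = k then 1 else 0) (n : ℕ) :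
    (stackedMatrix A B n 0).det * (∏ i : Fin n, L i i) ^ 2 = 1 := by
  set T : Matrix (Fin n) (Fin n) R := Matrix.of fun i j => L i j with hT
  have hTdet : T.det = ∏ i : Fin n, L i i := by
    rw [Matrix.det_of_isLowerTriangular]
    · simp [hT]
    · intro i j hij
      exact hL _ _ hij
  have h : T * stackedMatrix A B n 0 * T.transpose = 1 := by
    ext i k
    simp only [Matrix.mul_apply, Matrix.transpose_apply, stackedMatrix, hT, Matrix.of_apply,
      Nat.sub_zero, Fin.is_lt, if_true]
    rw [hA n i k i.2 k.2]
    simp [Matrix.one_apply, Fin.ext_iff]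
  have h' := congrArg Matrix.det h
  rw [Matrix.det_mul, Matrix.det_mul, Matrix.det_transpose, Matrix.det_one, hTdet] at h'
  linear_combination h'

theorem det_stackedMatrix_one_mul_prod (A L : ℕ → ℕ → R) (r : ℕ → R)
    (hL : ∀ i j, i < j → L i j = 0)
    (hA : ∀ N i k, i < N → k < N →
      ∑ a : Fin N, (∑ b : Fin N, L i b * A b a) * L k a = if i = k then 1 else 0) (n : ℕ) :
    (∏ i : Fin n, L i i) * (∏ i : Fin (n + 1), L i i) *
      (stackedMatrix A (fun _ => r) (n + 1) 1).det = ∑ j : Fin (n + 1), r j * L n j := by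
  set T : Matrix (Fin (n + 1)) (Fin (n + 1)) R := Matrix.of fun i j => L i j with hT
  set S : Matrix (Fin (n + 1)) (Fin (n + 1)) R :=
    Matrix.of fun i j => if (i : ℕ) < n then L i j else if i = j then 1 else 0 with hS
  have hTdet : T.det = ∏ i : Fin (n + 1), L i i := by
    rw [Matrix.det_of_isLowerTriangular]
    · simp [hT]
    · intro i j hij
      exact hL _ _ hij
  have hSdet : S.det = ∏ i : Fin n, L i i := by
    rw [Matrix.det_of_isLowerTriangular, Fin.prod_univ_castSucc]
    · simp [hS]
    · intro i j hij
      have hij' : (i : ℕ) < j := hij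
      simp only [hS, Matrix.of_apply]
      rw [hL _ _ hij', if_neg (c := i = j) (fun h => by simp [h] at hij'), ite_self]
  set M := S * stackedMatrix A (fun _ => r) (n + 1) 1 * T.transpose with hM
  have hMlt : ∀ i k : Fin (n + 1), (i : ℕ) < n → M i k = if i = k then 1 else 0 := by
    intro i k hi
    have h := hA (n + 1) i k i.2 k.2
    simp only [Fin.val_inj] at h
    rw [← h]
    simp only [hM, Matrix.mul_apply, Matrix.transpose_apply, stackedMatrix, hT, hS,
      Matrix.of_apply, hi, if_true]
    refine Finset.sum_congr rfl fun a _ => ?_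
    congr 1
    refine Finset.sum_congr rfl fun b _ => ?_
    by_cases hb : (b : ℕ) < n
    · simp [hb]
    · rw [hL i b (by omega), zero_mul, zero_mul]
  have hMlast : M (Fin.last n) (Fin.last n) = ∑ j : Fin (n + 1), r j * L n j := by
    have hSlast : ∀ j, S (Fin.last n) j = if Fin.last n = j then 1 else 0 := fun j => by
      simp [hS]
    simp only [hM, Matrix.mul_apply, hSlast, ite_mul, one_mul, zero_mul, Finset.sum_ite_eq,
      Finset.mem_univ, if_true]
    simp [stackedMatrix, hT]
  have hMdet : M.det = ∑ j : Fin (n + 1), r j * L n j := by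
    rw [Matrix.det_of_isLowerTriangular, Fin.prod_univ_castSucc, hMlast,
      Finset.prod_eq_one, one_mul]
    · intro i _
      rw [hMlt _ _ (by simp), if_pos rfl]
    · intro i j hij
      have hij' : (i : ℕ) < j := hij
      rw [hMlt _ _ (by omega), if_neg (fun h => by simp [h] at hij')]
  rw [← hMdet, hM, Matrix.det_mul, Matrix.det_mul, Matrix.det_transpose, hTdet, hSdet]
  ring

end Algebra

/-- Andréief's identity. -/
theorem integral_det_mul_det_mul_prod {ι : Type*} [Fintype ι] [DecidableEq ι] (f g : ι → ℝ → ℂ)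
    (V : ℝ → ℂ) (hint : ∀ i j, Integrable (fun x => f i x * g j x * V x)) :
    ∫ l : ι → ℝ, (Matrix.of fun i k => f i (l k)).det * (Matrix.of fun i k => g i (l k)).det *
        ∏ i, V (l i) =
      (Nat.factorial (Fintype.card ι) : ℂ) *
        (Matrix.of fun i j => ∫ x, f i x * g j x * V x).det := by
  have hexp : ∀ l : ι → ℝ, (Matrix.of fun i k => f i (l k)).det *
      (Matrix.of fun i k => g i (l k)).det * ∏ i, V (l i) =
      ∑ τ : Equiv.Perm ι, ∑ σ : Equiv.Perm ι,
        ((Equiv.Perm.sign τ : ℤ) : ℂ) * (((Equiv.Perm.sign σ : ℤ) : ℂ) *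
          ∏ k, (f (σ k) (l k) * g (τ k) (l k) * V (l k))) := by
    intro l
    rw [Matrix.det_apply', Matrix.det_apply', Finset.sum_mul_sum, Finset.sum_comm,
      Finset.sum_mul]
    refine Finset.sum_congr rfl fun τ _ => ?_
    rw [Finset.sum_mul]
    refine Finset.sum_congr rfl fun σ _ => ?_
    simp only [Finset.prod_mul_distrib, Matrix.of_apply]
    ring
  have hterm : ∀ τ σ : Equiv.Perm ι, Integrable (fun l : ι → ℝ =>
      ((Equiv.Perm.sign τ : ℤ) : ℂ) * (((Equiv.Perm.sign σ : ℤ) : ℂ) *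
          ∏ k, (f (σ k) (l k) * g (τ k) (l k) * V (l k)))) := fun τ σ =>
    ((Integrable.fintype_prod_dep (f := fun k x => f (σ k) x * g (τ k) x * V x)
      fun k => hint (σ k) (τ k)).const_mul _).const_mul _
  simp only [hexp]
  rw [integral_finsetSum _ fun τ _ => integrable_finsetSum _ fun σ _ => hterm τ σ]
  have hτ : ∀ τ : Equiv.Perm ι, ∫ l : ι → ℝ, ∑ σ : Equiv.Perm ι,
        ((Equiv.Perm.sign τ : ℤ) : ℂ) * (((Equiv.Perm.sign σ : ℤ) : ℂ) *
          ∏ k, (f (σ k) (l k) * g (τ k) (l k) * V (l k))) =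
      (Matrix.of fun i j => ∫ x, f i x * g j x * V x).det := by
    intro τ
    rw [integral_finsetSum _ fun σ _ => hterm τ σ]
    have hsub := Matrix.det_permute' τ (Matrix.of fun i j => ∫ x, f i x * g j x * V x)
    rw [Matrix.det_apply'] at hsub
    simp only [integral_const_mul]
    rw [← Finset.mul_sum]
    have : ∀ σ : Equiv.Perm ι, ∫ l : ι → ℝ, ∏ k, (f (σ k) (l k) * g (τ k) (l k) * V (l k)) =
        ∏ k, ∫ x, f (σ k) x * g (τ k) x * V x := fun σ =>
      integral_fintype_prod_volume_eq_prod (fun k x => f (σ k) x * g (τ k) x * V x)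
    simp only [this]
    simp only [Matrix.submatrix_apply, Matrix.of_apply, id] at hsub
    rw [hsub, ← mul_assoc, ← Int.cast_mul, Int.units_coe_mul_self, Int.cast_one, one_mul]
  simp only [hτ]
  simp [Fintype.card_perm]

/-- The moments `∫ x^i x^j V(x) dx`. -/
noncomputable def powMoment (V : ℝ → ℂ) (i j : ℕ) : ℂ := ∫ x : ℝ, (x : ℂ) ^ i * (x : ℂ) ^ j * V x

/-- The exponential moments `∫ e^{a_k x} x^j V(x) dx`. -/
noncomputable def expMoment (V : ℝ → ℂ) (a : ℕ → ℝ) (k j : ℕ) : ℂ :=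
  ∫ x : ℝ, Complex.exp ((a k : ℂ) * x) * (x : ℂ) ^ j * V x

/-- The normalization constant in `ZpartC`. -/
noncomputable def sourceNorm (d m : ℕ) (a : ℕ → ℝ) : ℂ :=
  (∏ i ∈ Finset.range (d - m), (Nat.factorial i : ℂ)) *
      (∏ p ∈ pairsBelow m, ((a p.2 : ℂ) - (a p.1 : ℂ))) *
      ∏ k ∈ Finset.range m, (a k : ℂ) ^ (d - m)

theorem sourceNorm_ne_zero (d m : ℕ) (a : ℕ → ℝ) (hane : ∀ i < m, a i ≠ 0)
    (hadist : ∀ i < m, ∀ j < m, i ≠ j → a i ≠ a j) : sourceNorm d m a ≠ 0 := by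
  refine mul_ne_zero (mul_ne_zero ?_ ?_) ?_
  · exact Finset.prod_ne_zero_iff.2 fun i _ => Nat.cast_ne_zero.2 (Nat.factorial_ne_zero i)
  · refine Finset.prod_ne_zero_iff.2 fun p hp => ?_
    simp only [pairsBelow, Finset.mem_filter, Finset.mem_product, Finset.mem_range] at hp
    rw [sub_ne_zero]
    exact_mod_cast hadist _ hp.1.2 _ hp.1.1 hp.2.ne'
  · refine Finset.prod_ne_zero_iff.2 fun k hk => pow_ne_zero _ ?_
    exact_mod_cast hane k (Finset.mem_range.1 hk)

theorem vandermondeProd_eq_det {d : ℕ} (l : Fin d → ℝ) :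
    (vandermondeProd l : ℂ) = (Matrix.of fun i k : Fin d => (l k : ℂ) ^ (i : ℕ)).det := by
  have h : (Matrix.of fun i k : Fin d => (l k : ℂ) ^ (i : ℕ)) =
      (Matrix.vandermonde fun k => (l k : ℂ)).transpose := by
    ext i k
    simp [Matrix.vandermonde]
  rw [h, Matrix.det_transpose, Matrix.det_vandermonde, vandermondeProd, Finset.prod_sigma',
    Complex.ofReal_prod]
  refine Finset.prod_bij' (fun p _ => ⟨p.1, p.2⟩) (fun p _ => (p.1, p.2)) ?_ ?_ ?_ ?_ ?_ <;>
    simp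

theorem ZpartC_eq (V : ℝ → ℂ) (a : ℕ → ℝ)
    (hpow : ∀ i j : ℕ, Integrable fun x : ℝ => (x : ℂ) ^ i * (x : ℂ) ^ j * V x)
    (hexp : ∀ k j : ℕ, Integrable fun x : ℝ => Complex.exp ((a k : ℂ) * x) * (x : ℂ) ^ j * V x)
    (d m : ℕ) :
    ZpartC V d m a = (sourceNorm d m a)⁻¹ *
      ((Nat.factorial d : ℂ) * (stackedMatrix (powMoment V) (expMoment V a) d m).det) := by
  let f : Fin d → ℝ → ℂ := fun i x => if (i : ℕ) < d - m then (x : ℂ) ^ (i : ℕ)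
    else Complex.exp ((a ((i : ℕ) - (d - m)) : ℂ) * x)
  have hint : ∀ i j : Fin d, Integrable fun x : ℝ => f i x * (x : ℂ) ^ (j : ℕ) * V x := by
    intro i j
    by_cases h : (i : ℕ) < d - m
    · simpa only [f, h, if_true] using hpow i j
    · simpa only [f, h, if_false] using hexp _ j
  have key := integral_det_mul_det_mul_prod f (fun j x => (x : ℂ) ^ (j : ℕ)) V hint
  simp only [← vandermondeProd_eq_det, Fintype.card_fin] at key
  unfold ZpartC
  refine congrArg₂ _ rfl (key.trans ?_)
  congr 2
  ext i j
  by_cases h : (i : ℕ) < d - m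
  · simp only [Matrix.of_apply, f, stackedMatrix, h, if_true, powMoment]
  · simp only [Matrix.of_apply, f, stackedMatrix, h, if_false, expMoment]

theorem integrable_exp_mul_pow_mul_weight (W : ℝ → ℝ)
    (hWint : ∀ (n : ℕ) (b : ℝ), Integrable (fun x => |x| ^ n * Real.exp (b * x) * W x))
    (hWmeas : Measurable W) (φ : ℝ → ℂ) (hφ : Measurable φ) (C : ℝ) (hC : ∀ x, ‖φ x‖ ≤ C)
    (n : ℕ) (b : ℝ) :
    Integrable fun x : ℝ => Complex.exp ((b : ℂ) * x) * (x : ℂ) ^ n * ((W x : ℂ) * φ x) := by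
  refine ((hWint n b).norm.const_mul C).mono' ?_ (Filter.Eventually.of_forall fun x => ?_)
  · exact Measurable.aestronglyMeasurable (by fun_prop)
  · rw [← Complex.ofReal_mul]
    simp only [norm_mul, norm_pow, Complex.norm_real, Complex.norm_exp, Complex.ofReal_re,
      Real.norm_eq_abs, Real.abs_exp, abs_abs]
    have := mul_le_mul_of_nonneg_left (hC x)
      (show 0 ≤ |x| ^ n * Real.exp (b * x) * |W x| by positivity)
    linarith

theorem integrable_weightC (W : ℝ → ℝ) (hWmeas : Measurable W)
    (hWint : ∀ (n : ℕ) (b : ℝ), Integrable (fun x => |x| ^ n * Real.exp (b * x) * W x))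
    (n : ℕ) (b : ℝ) :
    Integrable fun x : ℝ => Complex.exp ((b : ℂ) * x) * (x : ℂ) ^ n * weightC W x := by
  simpa [weightC] using integrable_exp_mul_pow_mul_weight W hWint hWmeas (fun _ => 1) measurable_const 1
    (by simp) n b

theorem integrable_weightEs (W : ℝ → ℝ) (hWmeas : Measurable W)
    (hWint : ∀ (n : ℕ) (b : ℝ), Integrable (fun x => |x| ^ n * Real.exp (b * x) * W x))
    (E : Set ℝ) (hE : MeasurableSet E) (s : ℂ) (n : ℕ) (b : ℝ) :
    Integrable fun x : ℝ => Complex.exp ((b : ℂ) * x) * (x : ℂ) ^ n * weightEs W E s x := by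
  refine integrable_exp_mul_pow_mul_weight W hWint hWmeas
    (fun x => 1 - s * E.indicator (fun _ => (1 : ℂ)) x)
    (((measurable_const.indicator hE).const_mul s).const_sub 1) (1 + ‖s‖) (fun x => ?_) n b
  refine (norm_sub_le _ _).trans ?_
  rw [norm_one, norm_mul]
  have : ‖E.indicator (fun _ => (1 : ℂ)) x‖ ≤ 1 := by
    by_cases h : x ∈ E <;> simp [h]
  nlinarith [norm_nonneg s]

theorem integrable_pow_of_integrable_exp (V : ℝ → ℂ)
    (hV : ∀ (n : ℕ) (b : ℝ), Integrable fun x : ℝ =>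
      Complex.exp ((b : ℂ) * x) * (x : ℂ) ^ n * V x) (i j : ℕ) :
    Integrable fun x : ℝ => (x : ℂ) ^ i * (x : ℂ) ^ j * V x := by
  simpa [pow_add] using hV (i + j) 0

theorem sum_sum_coeff_mul_powMoment (W : ℝ → ℝ) (P Q : Polynomial ℝ) (N : ℕ)
    (hP : P.natDegree < N) (hQ : Q.natDegree < N)
    (hpow : ∀ i j : ℕ, Integrable fun x : ℝ => (x : ℂ) ^ i * (x : ℂ) ^ j * weightC W x) :
    ∑ a : Fin N, (∑ b : Fin N, (P.coeff b : ℂ) * powMoment (weightC W) b a) * (Q.coeff a : ℂ) =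
      ((∫ x : ℝ, P.eval x * Q.eval x * W x : ℝ) : ℂ) := by
  rw [← integral_complex_ofReal]
  have h : ∀ x : ℝ, ((P.eval x * Q.eval x * W x : ℝ) : ℂ) = ∑ a : Fin N, ∑ b : Fin N,
      (P.coeff b : ℂ) * ((x : ℂ) ^ (b : ℕ) * (x : ℂ) ^ (a : ℕ) * weightC W x) *
        (Q.coeff a : ℂ) := by
    intro x
    rw [Polynomial.eval_eq_sum_range' hP, Polynomial.eval_eq_sum_range' hQ,
      ← Fin.sum_univ_eq_sum_range (fun i => P.coeff i * x ^ i),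
      ← Fin.sum_univ_eq_sum_range (fun i => Q.coeff i * x ^ i)]
    push_cast
    rw [Finset.sum_mul_sum, Finset.sum_comm, Finset.sum_mul]
    refine Finset.sum_congr rfl fun a _ => ?_
    rw [Finset.sum_mul]
    refine Finset.sum_congr rfl fun b _ => ?_
    simp only [weightC]
    ring
  simp only [h]
  have hint : ∀ a b : Fin N, Integrable fun x : ℝ =>
      (P.coeff b : ℂ) * ((x : ℂ) ^ (b : ℕ) * (x : ℂ) ^ (a : ℕ) * weightC W x) *
        (Q.coeff a : ℂ) := fun a b => ((hpow b a).const_mul _).mul_const _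
  rw [integral_finsetSum _ fun a _ => integrable_finsetSum _ fun b _ => hint a b]
  refine Finset.sum_congr rfl fun a _ => ?_
  rw [integral_finsetSum _ fun b _ => hint a b, Finset.sum_mul]
  refine Finset.sum_congr rfl fun b _ => ?_
  rw [integral_mul_const, integral_const_mul, powMoment]

theorem sum_expMoment_mul_coeff (W : ℝ → ℝ) (P : ℕ → Polynomial ℝ) (j N : ℕ)
    (hP : (P j).natDegree < N) (a : ℕ → ℝ) (k : ℕ)
    (hexp : ∀ i : ℕ, Integrable fun x : ℝ =>
      Complex.exp ((a k : ℂ) * x) * (x : ℂ) ^ i * weightC W x) :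
    ∑ i : Fin N, expMoment (weightC W) a k i * ((P j).coeff i : ℂ) = (GammaW W P j (a k) : ℂ) := by
  rw [GammaW, ← integral_complex_ofReal]
  have h : ∀ x : ℝ, (((P j).eval x * Real.exp (a k * x) * W x : ℝ) : ℂ) = ∑ i : Fin N,
      (Complex.exp ((a k : ℂ) * x) * (x : ℂ) ^ (i : ℕ) * weightC W x) * ((P j).coeff i : ℂ) := by
    intro x
    rw [Polynomial.eval_eq_sum_range' hP,
      ← Fin.sum_univ_eq_sum_range (fun i => (P j).coeff i * x ^ i)]
    push_cast
    rw [Finset.sum_mul, Finset.sum_mul]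
    refine Finset.sum_congr rfl fun i _ => ?_
    simp only [weightC]
    ring
  simp only [h]
  have hint : ∀ i : Fin N, Integrable fun x : ℝ =>
      (Complex.exp ((a k : ℂ) * x) * (x : ℂ) ^ (i : ℕ) * weightC W x) * ((P j).coeff i : ℂ) :=
    fun i => (hexp i).mul_const _
  rw [integral_finsetSum _ fun i _ => hint i]
  refine Finset.sum_congr rfl fun i _ => ?_
  rw [integral_mul_const, expMoment]

theorem det_stackedMatrix_ne_zero_of_ZpartC_ne_zero (V : ℝ → ℂ)
    (hV : ∀ (n : ℕ) (b : ℝ), Integrable fun x : ℝ =>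
      Complex.exp ((b : ℂ) * x) * (x : ℂ) ^ n * V x) (d m : ℕ) (a : ℕ → ℝ)
    (hZ : ZpartC V d m a ≠ 0) :
    (stackedMatrix (powMoment V) (expMoment V a) d m).det ≠ 0 := by
  intro h
  rw [ZpartC_eq V a (integrable_pow_of_integrable_exp V hV) (fun k j => hV j (a k)), h] at hZ
  simp at hZ

theorem Efrak_eq (W : ℝ → ℝ) (hWmeas : Measurable W)
    (hWint : ∀ (n : ℕ) (b : ℝ), Integrable (fun x => |x| ^ n * Real.exp (b * x) * W x))
    (E : Set ℝ) (hE : MeasurableSet E) (s : ℂ) (d m : ℕ) (a : ℕ → ℝ)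
    (hane : ∀ i < m, a i ≠ 0) (hadist : ∀ i < m, ∀ j < m, i ≠ j → a i ≠ a j) :
    Efrak W E s d m a =
      (stackedMatrix (powMoment (weightEs W E s)) (expMoment (weightEs W E s) a) d m).det /
        (stackedMatrix (powMoment (weightC W)) (expMoment (weightC W) a) d m).det := by
  have h₁ := integrable_weightC W hWmeas hWint
  have h₂ := integrable_weightEs W hWmeas hWint E hE s
  rw [Efrak, ZpartC_eq _ a (integrable_pow_of_integrable_exp _ h₁) (fun k j => h₁ j (a k)),
    ZpartC_eq _ a (integrable_pow_of_integrable_exp _ h₂) (fun k j => h₂ j (a k)),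
    mul_div_mul_left _ _ (inv_ne_zero (sourceNorm_ne_zero d m a hane hadist)),
    mul_div_mul_left _ _ (Nat.cast_ne_zero.2 (Nat.factorial_ne_zero d))]

/-- Evaluation of the determinantal ratio once the Sylvester-type identity is available for two
families of moments. -/
theorem det_ratio_eq {K : Type*} [Field K] (A B A' B' : ℕ → ℕ → K) (p m : ℕ) (c : ℕ → K)
    (hc : ∀ n, c n ≠ 0)
    (hH : ∀ l ≤ m, (stackedMatrix A B (p + l + 1) 0).det ≠ 0)
    (hH' : ∀ l ≤ m, (stackedMatrix A' B' (p + l + 1) 0).det ≠ 0)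
    (hD : (stackedMatrix A B (p + (m + 1)) (m + 1)).det ≠ 0)
    (hG : ∀ l ≤ m, ∀ k ≤ m, (stackedMatrix A (fun _ => B k) (p + l + 1) 1).det ≠ 0) :
    (Matrix.of fun j k : Fin (m + 1) =>
        c (p + j.rev) * (stackedMatrix A (fun _ => B k) (p + j.rev + 1) 1).det *
          ((stackedMatrix A' (fun _ => B' k) (p + j.rev + 1) 1).det /
            (stackedMatrix A (fun _ => B k) (p + j.rev + 1) 1).det /
            ((stackedMatrix A' B' (p + j.rev + 1) 0).det /
              (stackedMatrix A B (p + j.rev + 1) 0).det))).det /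
      (Matrix.of fun j k : Fin (m + 1) =>
        c (p + j.rev) * (stackedMatrix A (fun _ => B k) (p + j.rev + 1) 1).det).det =
    (stackedMatrix A' B' (p + (m + 1)) (m + 1)).det /
        (stackedMatrix A B (p + (m + 1)) (m + 1)).det /
      ((stackedMatrix A' B' (p + (m + 1)) 0).det / (stackedMatrix A B (p + (m + 1)) 0).det) := by
  have key := det_stackedMatrix_mul_prod_succ A B p m
  have key' := det_stackedMatrix_mul_prod_succ A' B' p m
  set M := Matrix.of fun l k : Fin (m + 1) =>
    (stackedMatrix A (fun _ => B k) (p + l + 1) 1).det with hM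
  set M' := Matrix.of fun l k : Fin (m + 1) =>
    (stackedMatrix A' (fun _ => B' k) (p + l + 1) 1).det with hM'
  set H : ℕ → K := fun l => (stackedMatrix A B (p + l + 1) 0).det with hHdef
  set H' : ℕ → K := fun l => (stackedMatrix A' B' (p + l + 1) 0).det with hHdef'
  have hden : (Matrix.of fun j k : Fin (m + 1) =>
      c (p + j.rev) * (stackedMatrix A (fun _ => B k) (p + j.rev + 1) 1).det).det =
      (∏ j : Fin (m + 1), c (p + j)) *
        ((Equiv.Perm.sign (Fin.revPerm : Equiv.Perm (Fin (m + 1))) : ℤ) * M.det) := by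
    rw [← Matrix.det_permute, ← Equiv.prod_comp Fin.revPerm (fun j : Fin (m + 1) => c (p + j)),
      ← Matrix.det_mul_column]
    rfl
  have hnum : (Matrix.of fun j k : Fin (m + 1) =>
      c (p + j.rev) * (stackedMatrix A (fun _ => B k) (p + j.rev + 1) 1).det *
          ((stackedMatrix A' (fun _ => B' k) (p + j.rev + 1) 1).det /
            (stackedMatrix A (fun _ => B k) (p + j.rev + 1) 1).det /
            ((stackedMatrix A' B' (p + j.rev + 1) 0).det /
              (stackedMatrix A B (p + j.rev + 1) 0).det))).det =
      (∏ j : Fin (m + 1), c (p + j) * H j / H' j) *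
        ((Equiv.Perm.sign (Fin.revPerm : Equiv.Perm (Fin (m + 1))) : ℤ) * M'.det) := by
    rw [← Matrix.det_permute,
      ← Equiv.prod_comp Fin.revPerm (fun j : Fin (m + 1) => c (p + j) * H j / H' j),
      ← Matrix.det_mul_column]
    congr 1
    ext j k
    have hj : (j.rev : ℕ) ≤ m := Nat.le_of_lt_succ j.rev.2
    have h₁ := hG _ hj k (Nat.le_of_lt_succ k.2)
    have h₂ := hH _ hj
    have h₃ := hH' _ hj
    simp only [Matrix.of_apply, Matrix.submatrix_apply, hM', Fin.revPerm_apply, id, hHdef, hHdef']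
    field_simp
  have hs : ((Equiv.Perm.sign (Fin.revPerm : Equiv.Perm (Fin (m + 1))) : ℤ) : K) ≠ 0 := by
    rcases Int.units_eq_one_or (Equiv.Perm.sign (Fin.revPerm : Equiv.Perm (Fin (m + 1)))) with h | h
      <;> simp [h]
  have hcprod : ∏ j : Fin (m + 1), c (p + j) ≠ 0 := Finset.prod_ne_zero_iff.2 fun j _ => hc _
  have hQ : ∏ l : Fin m, H l ≠ 0 := Finset.prod_ne_zero_iff.2 fun l _ => hH _ l.2.le
  have hQ' : ∏ l : Fin m, H' l ≠ 0 := Finset.prod_ne_zero_iff.2 fun l _ => hH' _ l.2.le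
  have hm : H m ≠ 0 := hH m le_rfl
  have hm' : H' m ≠ 0 := hH' m le_rfl
  change _ * ∏ l : Fin m, H l = _ at key
  change _ * ∏ l : Fin m, H' l = _ at key'
  rw [hnum, hden, ← key, ← key', Finset.prod_div_distrib, Finset.prod_mul_distrib,
    Fin.prod_univ_castSucc (fun j : Fin (m + 1) => H j),
    Fin.prod_univ_castSucc (fun j : Fin (m + 1) => H' j)]
  change _ = _ / _ / (H' m / H m)
  simp only [Fin.val_castSucc, Fin.val_last]
  field_simp

/-- The main identity: reduction of the rank-`m` expectation to rank-one expectations,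
`𝔈̄_d(a_1,…,a_m; E; s) = det[Γ_{d−j}(a_k) 𝔈̄_{d−j+1}(a_k; E; s)] / det[Γ_{d−j}(a_k)]`. -/
theorem Ebar_eq_det_ratio_Gamma
    (W : ℝ → ℝ) (hWmeas : Measurable W) (hWnonneg : ∀ x, 0 ≤ W x)
    (hWsupp : (Function.support W).Infinite)
    (hWint : ∀ (n : ℕ) (b : ℝ), Integrable (fun x => |x| ^ n * Real.exp (b * x) * W x))
    (P : ℕ → Polynomial ℝ)
    (hPdeg : ∀ j, (P j).natDegree = j)
    (hPlead : ∀ j, 0 < (P j).leadingCoeff)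
    (hPorth : ∀ j k, ∫ x : ℝ, (P j).eval x * (P k).eval x * W x = if j = k then 1 else 0)
    (m d : ℕ) (hm : 1 ≤ m) (hmd : m ≤ d)
    (a : ℕ → ℝ)
    (hane : ∀ i < m, a i ≠ 0)
    (hadist : ∀ i < m, ∀ j < m, i ≠ j → a i ≠ a j)
    (E : Set ℝ) (hE : MeasurableSet E) (s : ℂ)
    (hZE : ZpartC (weightEs W E s) d 0 a ≠ 0)
    (hZEj : ∀ j < m, ZpartC (weightEs W E s) (d - j) 0 a ≠ 0)
    (hZa : ZpartC (weightC W) d m a ≠ 0)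
    (hZjk : ∀ j < m, ∀ k < m, ZpartC (weightC W) (d - j) 1 (fun _ => a k) ≠ 0)
    (hdet : (Matrix.of fun j k : Fin m =>
        (GammaW W P (d - 1 - (j : ℕ)) (a (k : ℕ)) : ℂ)).det ≠ 0) :
    Ebar W E s d m a =
      (Matrix.of fun j k : Fin m =>
          (GammaW W P (d - 1 - (j : ℕ)) (a (k : ℕ)) : ℂ) *
            Ebar W E s (d - (j : ℕ)) 1 (fun _ => a (k : ℕ))).det /
        (Matrix.of fun j k : Fin m =>
            (GammaW W P (d - 1 - (j : ℕ)) (a (k : ℕ)) : ℂ)).det := by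
  obtain ⟨m, rfl⟩ : ∃ n, m = n + 1 := ⟨m - 1, by omega⟩
  obtain ⟨p, rfl⟩ : ∃ p, d = p + (m + 1) := ⟨d - (m + 1), by omega⟩
  have h₁ := integrable_weightC W hWmeas hWint
  have h₂ := integrable_weightEs W hWmeas hWint E hE s
  set A := powMoment (weightC W) with hA
  set B := expMoment (weightC W) a with hB
  set A' := powMoment (weightEs W E s) with hA'
  set B' := expMoment (weightEs W E s) a with hB'
  let L : ℕ → ℕ → ℂ := fun i j => ((P i).coeff j : ℂ)
  have hLdiag : ∀ i, L i i ≠ 0 := fun i => by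
    have h := (hPlead i).ne'
    rw [Polynomial.leadingCoeff, hPdeg] at h
    exact Complex.ofReal_ne_zero.2 h
  have hLlow : ∀ i j, i < j → L i j = 0 := fun i j hij => by
    have h : (P i).coeff j = 0 :=
      Polynomial.coeff_eq_zero_of_natDegree_lt (by rwa [hPdeg])
    simp [L, h]
  have hortho : ∀ N i k, i < N → k < N →
      ∑ a : Fin N, (∑ b : Fin N, L i b * A b a) * L k a = if i = k then 1 else 0 := by
    intro N i k hi hk
    rw [sum_sum_coeff_mul_powMoment W (P i) (P k) N (by rwa [hPdeg]) (by rwa [hPdeg])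
      (integrable_pow_of_integrable_exp _ h₁), hPorth]
    split_ifs <;> simp
  let c : ℕ → ℂ := fun n => (∏ i : Fin n, L i i) * ∏ i : Fin (n + 1), L i i
  have hc : ∀ n, c n ≠ 0 := fun n => mul_ne_zero
    (Finset.prod_ne_zero_iff.2 fun i _ => hLdiag i) (Finset.prod_ne_zero_iff.2 fun i _ => hLdiag i)
  have hΓ : ∀ n k, (GammaW W P n (a k) : ℂ) =
      c n * (stackedMatrix A (fun _ => B k) (n + 1) 1).det := fun n k => by
    rw [det_stackedMatrix_one_mul_prod A L (B k) hLlow hortho n,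
      ← sum_expMoment_mul_coeff W P n (n + 1) (by rw [hPdeg]; exact n.lt_succ_self) a k
        (fun i => h₁ i (a k))]
  have hEbar : ∀ n k, k ≤ m → Ebar W E s (n + 1) 1 (fun _ => a k) =
      (stackedMatrix A' (fun _ => B' k) (n + 1) 1).det /
        (stackedMatrix A (fun _ => B k) (n + 1) 1).det /
        ((stackedMatrix A' B' (n + 1) 0).det / (stackedMatrix A B (n + 1) 0).det) := by
    intro n k hk
    rw [Ebar, Efrak_eq W hWmeas hWint E hE s _ 1 _ (fun _ _ => hane k (by omega))
        (fun i hi j hj hij => absurd (by omega) hij),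
      Efrak_eq W hWmeas hWint E hE s _ 0 _ (by simp) (by simp)]
    simp only [det_stackedMatrix_zero]
    rfl
  have hidx : ∀ j : Fin (m + 1), p + (m + 1) - 1 - (j : ℕ) = p + j.rev ∧
      p + (m + 1) - (j : ℕ) = p + j.rev + 1 := fun j => by
    rw [Fin.val_rev]
    omega
  have hnum : (Matrix.of fun j k : Fin (m + 1) =>
      (GammaW W P (p + (m + 1) - 1 - (j : ℕ)) (a (k : ℕ)) : ℂ) *
        Ebar W E s (p + (m + 1) - (j : ℕ)) 1 (fun _ => a (k : ℕ))) =
      Matrix.of fun j k : Fin (m + 1) =>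
        c (p + j.rev) * (stackedMatrix A (fun _ => B k) (p + j.rev + 1) 1).det *
          ((stackedMatrix A' (fun _ => B' k) (p + j.rev + 1) 1).det /
            (stackedMatrix A (fun _ => B k) (p + j.rev + 1) 1).det /
            ((stackedMatrix A' B' (p + j.rev + 1) 0).det /
              (stackedMatrix A B (p + j.rev + 1) 0).det)) := by
    ext j k
    simp only [Matrix.of_apply]
    rw [(hidx j).1, (hidx j).2, hΓ, hEbar _ _ (Nat.le_of_lt_succ k.2)]
  have hden : (Matrix.of fun j k : Fin (m + 1) =>
      (GammaW W P (p + (m + 1) - 1 - (j : ℕ)) (a (k : ℕ)) : ℂ)) =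
      Matrix.of fun j k : Fin (m + 1) =>
        c (p + j.rev) * (stackedMatrix A (fun _ => B k) (p + j.rev + 1) 1).det := by
    ext j k
    simp only [Matrix.of_apply]
    rw [(hidx j).1, hΓ]
  have hsub : ∀ l ≤ m, p + (m + 1) - (m - l) = p + l + 1 := fun l hl => by omega
  rw [hnum, hden, det_ratio_eq A B A' B' p m c hc, Ebar,
    Efrak_eq W hWmeas hWint E hE s _ _ _ hane hadist,
    Efrak_eq W hWmeas hWint E hE s _ 0 _ (by simp) (by simp)]
  · intro l _ h
    have := det_stackedMatrix_zero_mul_sq A B L hLlow hortho (p + l + 1)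
    simp [h] at this
  · intro l hl
    have := hZEj (m - l) (by omega)
    rw [hsub l hl] at this
    exact det_stackedMatrix_ne_zero_of_ZpartC_ne_zero _ h₂ _ _ _ this
  · exact det_stackedMatrix_ne_zero_of_ZpartC_ne_zero _ h₁ _ _ _ hZa
  · intro l hl k hk
    have := hZjk (m - l) (by omega) k (by omega)
    rw [hsub l hl] at this
    exact det_stackedMatrix_ne_zero_of_ZpartC_ne_zero _ h₁ _ _ _ this
end

section
/- Let d ≥ 1 and let a_1, …, a_d and λ_1, …, λ_d be complex numbers. Then det[ e^{a_j λ_k} ]_{j,k=1}^{d} = (1/d!) · Σ_{(n_1,…,n_d) ∈ ℕ^d} det[ a_j^{n_q} ]_{j,q=1}^{d} · det[ λ_j^{n_q} ]_{j,q=1}^{d} / (n_1! ⋯ n_d!), where the series over all d-tuples of nonnegative integers converges absolutely. -/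
/-- A product of finitely many absolutely convergent series is the sum over all tuples of
indices of the products of the terms. -/
theorem hasSum_prod_fin_of_summable_norm {R ι : Type*} [NormedCommRing R] [CompleteSpace R]
    {d : ℕ} {f : Fin d → ι → R} {s : Fin d → R} (hf : ∀ i, Summable fun n => ‖f i n‖)
    (hs : ∀ i, HasSum (f i) (s i)) :
    (Summable fun n : Fin d → ι => ‖∏ i, f i (n i)‖) ∧
      HasSum (fun n : Fin d → ι => ∏ i, f i (n i)) (∏ i, s i) := by
  induction d with
  | zero =>
    refine ⟨(hasSum_fintype _).summable, ?_⟩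
    simp
  | succ d ih =>
    obtain ⟨ihn, ihs⟩ := ih (fun i => hf i.succ) (fun i => hs i.succ)
    rw [← (Fin.consEquiv fun _ : Fin (d + 1) => ι).summable_iff,
      ← (Fin.consEquiv fun _ : Fin (d + 1) => ι).hasSum_iff, Fin.prod_univ_succ s]
    have hn : Summable fun x : ι × (Fin d → ι) => ‖f 0 x.1 * ∏ i, f (Fin.succ i) (x.2 i)‖ :=
      Summable.mul_norm (R := R) (f := f 0) (g := fun n : Fin d → ι => ∏ i, f (Fin.succ i) (n i))
        (hf 0) ihn
    have hp := (hs 0).mul ihs hn.of_norm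
    constructor
    · simpa [Function.comp_def, Fin.consEquiv, Fin.prod_univ_succ] using hn
    · simpa [Function.comp_def, Fin.consEquiv, Fin.prod_univ_succ] using hp

/-- The sum over all `d`-tuples of nonnegative integers of the products of two generalized
Vandermonde determinants, weighted by inverse factorials. -/
theorem hasSum_det_pow_mul_det_pow_div_factorial {d : ℕ} (a l : Fin d → ℂ) :
    HasSum (fun n : Fin d → ℕ =>
      (Matrix.of fun j q : Fin d => a j ^ n q).det *
        (Matrix.of fun j q : Fin d => l j ^ n q).det / ∏ q : Fin d, ((n q).factorial : ℂ))
      ((d.factorial : ℂ) * (Matrix.of fun j k : Fin d => Complex.exp (a j * l k)).det) := by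
  have key (σ τ : Equiv.Perm (Fin d)) :
      HasSum (fun n : Fin d → ℕ => ∏ q, (a (σ q) * l (τ q)) ^ n q / ((n q).factorial : ℂ))
        (∏ q, Complex.exp (a (σ q) * l (τ q))) := by
    refine (hasSum_prod_fin_of_summable_norm (fun q =>
      NormedSpace.norm_expSeries_div_summable (a (σ q) * l (τ q))) fun q => ?_).2
    rw [Complex.exp_eq_exp_ℂ]
    exact NormedSpace.expSeries_div_hasSum_exp (a (σ q) * l (τ q))
  have hsum := hasSum_sum (s := Finset.univ) fun τ _ => hasSum_sum (s := Finset.univ) fun σ _ =>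
    (key σ τ).mul_left (((Equiv.Perm.sign τ : ℤ) : ℂ) * ((Equiv.Perm.sign σ : ℤ) : ℂ))
  have inner (τ : Equiv.Perm (Fin d)) :
      ∑ σ : Equiv.Perm (Fin d), ((Equiv.Perm.sign τ : ℤ) : ℂ) * ((Equiv.Perm.sign σ : ℤ) : ℂ) *
        ∏ q, Complex.exp (a (σ q) * l (τ q)) =
      (Matrix.of fun j k : Fin d => Complex.exp (a j * l k)).det := by
    have h := Matrix.det_permute' τ (Matrix.of fun j k : Fin d => Complex.exp (a j * l k))
    rw [Matrix.det_apply'] at h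
    simp only [Matrix.submatrix_apply, Matrix.of_apply, id_eq] at h
    simp only [mul_assoc]
    rw [← Finset.mul_sum, h, ← mul_assoc, ← Int.cast_mul, ← Units.val_mul, Int.units_mul_self]
    simp
  simp only [inner, Finset.sum_const, Finset.card_univ, Fintype.card_perm, Fintype.card_fin,
    nsmul_eq_mul] at hsum
  refine (congrArg (HasSum · _) (funext fun n => ?_)).mpr hsum
  rw [mul_comm, Matrix.det_apply', Matrix.det_apply', Finset.sum_mul_sum, Finset.sum_div]
  refine Finset.sum_congr rfl fun τ _ => ?_
  rw [Finset.sum_div]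
  refine Finset.sum_congr rfl fun σ _ => ?_
  simp only [Matrix.of_apply, Finset.prod_div_distrib, mul_pow, Finset.prod_mul_distrib]
  ring

/-- Expansion of `det[e^{a_j λ_k}]` as an absolutely convergent series over all
`d`-tuples of nonnegative integers. -/
theorem det_exp_eq_sum_over_tuples (d : ℕ) (hd : 1 ≤ d) (a l : Fin d → ℂ) :
    Summable (fun n : Fin d → ℕ =>
      ‖(Matrix.of fun j q : Fin d => a j ^ n q).det *
          (Matrix.of fun j q : Fin d => l j ^ n q).det /
          ∏ q : Fin d, ((n q).factorial : ℂ)‖) ∧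
    (Matrix.of fun j k : Fin d => Complex.exp (a j * l k)).det =
      (1 / (d.factorial : ℂ)) *
        ∑' n : Fin d → ℕ,
          (Matrix.of fun j q : Fin d => a j ^ n q).det *
            (Matrix.of fun j q : Fin d => l j ^ n q).det /
            ∏ q : Fin d, ((n q).factorial : ℂ) := by
  have h := hasSum_det_pow_mul_det_pow_div_factorial a l
  refine ⟨h.summable.norm, ?_⟩
  rw [h.tsum_eq, one_div, inv_mul_cancel_left₀ (Nat.cast_ne_zero.mpr d.factorial_ne_zero)]
end

section
/- Let d ≥ 1 and let a_1, …, a_d and λ_1, …, λ_d be complex numbers. Then det[ e^{a_j λ_k} ]_{j,k=1}^{d} = Σ_{j_1 > j_2 > ⋯ > j_d ≥ 0} det[ a_p^{j_q} ]_{p,q=1}^{d} · det[ λ_p^{j_q} ]_{p,q=1}^{d} / (j_1! ⋯ j_d!), where the sum ranges over all strictly decreasing d-tuples of nonnegative integers and converges absolutely. -/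
open scoped BigOperators

/-- A finite product of absolutely convergent series expands into an absolutely convergent
series indexed by tuples. -/
theorem hasSum_prod_pi_of_summable {𝕜 α : Type*} [RCLike 𝕜] {d : ℕ} (w : Fin d → α → 𝕜)
    (hw : ∀ i, Summable (w i)) :
    HasSum (fun f : Fin d → α => ∏ i, w i (f i)) (∏ i, ∑' n, w i n) := by
  induction d with
  | zero => simp
  | succ d ih =>
    have h := ih (fun i => w i.succ) fun i => hw i.succ
    have hs := summable_mul_of_summable_norm (hw 0).norm h.summable.norm
    have hmul := (hw 0).hasSum.mul h hs
    rw [← (Fin.consEquiv fun _ => α).hasSum_iff, Fin.prod_univ_succ]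
    refine hmul.congr_fun ?_
    intro x
    simp [Fin.consEquiv, Fin.prod_univ_succ]

/-- Every injective tuple is, in a unique way, a permutation of a strictly decreasing tuple. -/
theorem bijective_strictAnti_comp_perm (α : Type*) [LinearOrder α] (d : ℕ) :
    Function.Bijective
      (fun x : {f : Fin d → α // StrictAnti f} × Equiv.Perm (Fin d) =>
        (⟨x.1.1 ∘ x.2, x.1.2.injective.comp x.2.injective⟩ :
          {f : Fin d → α // Function.Injective f})) := by
  constructor
  · rintro ⟨⟨g, hg⟩, s⟩ ⟨⟨g', hg'⟩, s'⟩ h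
    have h : g ∘ s = g' ∘ s' := congrArg Subtype.val h
    have hr : Set.range (OrderDual.toDual ∘ g) = Set.range (OrderDual.toDual ∘ g') := by
      rw [Set.range_comp, Set.range_comp, ← s.surjective.range_comp g, h, s'.surjective.range_comp]
    have hgg : g = g' := (hg.dual_right.range_inj hg'.dual_right).1 hr
    subst hgg
    have hss : s = s' := Equiv.ext fun i => hg.injective (congrFun h i)
    rw [hss]
  · rintro ⟨f, hf⟩
    let s := Tuple.sort (OrderDual.toDual ∘ f)
    have hs : Antitone (f ∘ s) := (Tuple.monotone_sort (OrderDual.toDual ∘ f)).dual_right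
    refine ⟨⟨⟨f ∘ s, hs.strictAnti_of_injective (hf.comp s.injective)⟩, s⁻¹⟩, ?_⟩
    ext i
    simp

/-- The Cauchy–Binet formula for infinite matrices with (absolutely) summable entries of the product. -/
theorem hasSum_det_mul_det_strictAnti {𝕜 α : Type*} [RCLike 𝕜] [LinearOrder α] {d : ℕ}
    (A B : Fin d → α → 𝕜) (hAB : ∀ p q, Summable fun n => A p n * B q n) :
    HasSum (fun f : {f : Fin d → α // StrictAnti f} =>
      (Matrix.of fun p q => A p (f.1 q)).det * (Matrix.of fun p q => B p (f.1 q)).det)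
      (Matrix.of fun p q => ∑' n, A p n * B q n).det := by
  have hall : HasSum
      (fun f : Fin d → α => (Matrix.of fun p q => A p (f q)).det * ∏ q, B q (f q))
      (Matrix.of fun p q => ∑' n, A p n * B q n).det := by
    simp only [Matrix.det_apply', Matrix.of_apply, Finset.sum_mul, mul_assoc,
      ← Finset.prod_mul_distrib]
    exact hasSum_sum fun s _ =>
      (hasSum_prod_pi_of_summable (fun q n => A (s q) n * B q n) fun q => hAB _ q).mul_left _
  have hinj : HasSum
      (fun f : {f : Fin d → α // Function.Injective f} =>
        (Matrix.of fun p q => A p (f.1 q)).det * ∏ q, B q (f.1 q))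
      (Matrix.of fun p q => ∑' n, A p n * B q n).det := by
    refine (hasSum_subtype_iff_of_support_subset (s := {f | Function.Injective f}) ?_).2 hall
    intro f hf
    by_contra hni
    simp only [Set.mem_ofPred_eq, Function.Injective, not_forall] at hni
    obtain ⟨i, j, hij, hne⟩ := hni
    refine hf ?_
    dsimp only
    rw [Matrix.det_zero_of_column_eq hne fun p => by simp [hij], zero_mul]
  have hprod := (Equiv.ofBijective _ (bijective_strictAnti_comp_perm α d)).hasSum_iff.2 hinj
  refine (hprod.prod_fiberwise fun g => hasSum_fintype _).congr_fun ?_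
  intro g
  rw [← Matrix.det_transpose (Matrix.of fun p q => B p (g.1 q)),
    Matrix.det_apply' (Matrix.of fun p q => B p (g.1 q)).transpose, Finset.mul_sum]
  refine Finset.sum_congr rfl fun s _ => ?_
  have hperm := Matrix.det_permute' s (Matrix.of fun p q => A p (g.1 q))
  have hsub : (Matrix.of fun p q => A p (g.1 q)).submatrix id s =
      Matrix.of fun p q => A p (g.1 (s q)) := rfl
  rw [hsub] at hperm
  simp only [Function.comp_apply, Equiv.ofBijective_apply, Matrix.transpose_apply,
    Matrix.of_apply, hperm]
  ring

/-- The exponential series of a product, with the factorials attached to the second factor. -/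
theorem hasSum_pow_mul_pow_div_factorial (z w : ℂ) :
    HasSum (fun n : ℕ => z ^ n * (w ^ n / (n.factorial : ℂ))) (Complex.exp (z * w)) := by
  have h := NormedSpace.expSeries_div_hasSum_exp (z * w)
  rw [← Complex.exp_eq_exp_ℂ] at h
  simpa only [mul_pow, mul_div_assoc] using h

/-- Column denominators factor out of a determinant. -/
theorem det_of_div_column {𝕜 n : Type*} [Field 𝕜] [Fintype n] [DecidableEq n]
    (M : n → n → 𝕜) (c : n → 𝕜) :
    (Matrix.of fun p q => M p q / c q).det = (Matrix.of M).det / ∏ q, c q := by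
  have h := Matrix.det_mul_row (fun q => (c q)⁻¹) (Matrix.of M)
  rw [Finset.prod_inv_distrib] at h
  rw [div_eq_inv_mul, ← h]
  congr 1
  ext p q
  simp [div_eq_inv_mul]

/-- Expansion of `det[e^{a_j λ_k}]` as an absolutely convergent series over all
strictly decreasing `d`-tuples `j_1 > j_2 > ⋯ > j_d ≥ 0` of nonnegative integers. -/
theorem det_exp_eq_sum_over_decreasing_tuples (d : ℕ) (hd : 1 ≤ d) (a l : Fin d → ℂ) :
    Summable (fun j : {f : Fin d → ℕ // StrictAnti f} =>
      ‖(Matrix.of fun p q : Fin d => a p ^ j.1 q).det *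
          (Matrix.of fun p q : Fin d => l p ^ j.1 q).det /
          ∏ q : Fin d, ((j.1 q).factorial : ℂ)‖) ∧
    (Matrix.of fun j k : Fin d => Complex.exp (a j * l k)).det =
      ∑' j : {f : Fin d → ℕ // StrictAnti f},
        (Matrix.of fun p q : Fin d => a p ^ j.1 q).det *
          (Matrix.of fun p q : Fin d => l p ^ j.1 q).det /
          ∏ q : Fin d, ((j.1 q).factorial : ℂ) := by
  have hsum : HasSum (fun j : {f : Fin d → ℕ // StrictAnti f} =>
        (Matrix.of fun p q : Fin d => a p ^ j.1 q).det *
          (Matrix.of fun p q : Fin d => l p ^ j.1 q).det /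
          ∏ q : Fin d, ((j.1 q).factorial : ℂ))
      (Matrix.of fun j k : Fin d => Complex.exp (a j * l k)).det := by
    have h := hasSum_det_mul_det_strictAnti (fun p (n : ℕ) => a p ^ n)
      (fun q n => l q ^ n / (n.factorial : ℂ))
      fun p q => (hasSum_pow_mul_pow_div_factorial (a p) (l q)).summable
    simp only [fun p q => (hasSum_pow_mul_pow_div_factorial (a p) (l q)).tsum_eq] at h
    refine h.congr_fun fun j => ?_
    rw [det_of_div_column (fun p q => l p ^ j.1 q) fun q => ((j.1 q).factorial : ℂ),
      mul_div_assoc]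
  exact ⟨hsum.summable.norm, hsum.tsum_eq.symm⟩
end

section
/- Let n ≥ 1, let t_1, …, t_n be elements of a commutative ℚ-algebra R, and let z be an invertible element of R. Then h_n(t_1 − z^{−1}, t_2 − z^{−2}/2, …, t_n − z^{−n}/n) = h_n(t_1, …, t_n) − z^{−1} · h_{n−1}(t_1, …, t_{n−1}). -/
open scoped BigOperators

/-- The elementary Schur polynomials `h_k`, defined by the generating function
`Σ_{k≥0} h_k(t) w^k = exp(Σ_{j≥1} t_j w^j)`; explicitly
`h_k(t₁,…,t_k) = Σ_{m₁+2m₂+⋯+k·m_k = k} ∏ t_i^{m_i}/m_i!`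
(the argument `t : ℕ → R` is used only at indices `1,…,k`). -/
noncomputable def schurH (R : Type*) [CommRing R] [Algebra ℚ R] (k : ℕ) (t : ℕ → R) : R :=
  ∑ m ∈ (Fintype.piFinset fun _ : Fin k => Finset.range (k + 1)).filter
      (fun m => ∑ i : Fin k, ((i : ℕ) + 1) * m i = k),
    ∏ i : Fin k, algebraMap ℚ R (((m i).factorial : ℚ)⁻¹) * t ((i : ℕ) + 1) ^ m i

namespace PowerSeries

variable {R : Type*} [CommRing R] [Algebra ℚ R]

/-- The power series `exp (a X ^ j)`, for `j ≥ 1`. -/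
noncomputable def expMonomial (j : ℕ) (a : R) : PowerSeries R :=
  PowerSeries.mk fun n =>
    if j ∣ n then algebraMap ℚ R (((n / j).factorial : ℚ)⁻¹) * a ^ (n / j) else 0

theorem coeff_expMonomial (j : ℕ) (a : R) (n : ℕ) :
    coeff n (expMonomial j a) =
      if j ∣ n then algebraMap ℚ R (((n / j).factorial : ℚ)⁻¹) * a ^ (n / j) else 0 := by
  simp [expMonomial]

theorem coeff_mul_expMonomial {j : ℕ} (hj : 0 < j) (a : R) (m : ℕ) :
    coeff (j * m) (expMonomial j a) = algebraMap ℚ R ((m.factorial : ℚ)⁻¹) * a ^ m := by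
  simp [coeff_expMonomial, Nat.mul_div_cancel_left m hj]

theorem coeff_expMonomial_of_not_dvd {j n : ℕ} (h : ¬ j ∣ n) (a : R) :
    coeff n (expMonomial j a) = 0 := by
  simp [coeff_expMonomial, h]

theorem derivative_expMonomial (i : ℕ) (a : R) :
    derivative R (expMonomial (i + 1) a) =
      expMonomial (i + 1) a * (C (((i : R) + 1) * a) * X ^ i) := by
  ext n
  rw [coeff_derivative, mul_left_comm, coeff_C_mul, coeff_mul_X_pow']
  by_cases h : i + 1 ∣ n + 1
  · obtain ⟨q, hq⟩ := h
    obtain _ | q := q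
    · simp at hq
    have hn : n = (i + 1) * q + i := by rw [mul_add] at hq; omega
    have hc : (n : R) + 1 = ((i : R) + 1) * algebraMap ℚ R (q + 1) := by
      rw [hn]; simp; ring
    have hf : algebraMap ℚ R (q + 1) * algebraMap ℚ R (((q + 1).factorial : ℚ)⁻¹) =
        algebraMap ℚ R ((q.factorial : ℚ)⁻¹) := by
      rw [← map_mul, Nat.factorial_succ]
      congr 1
      push_cast
      field_simp
    rw [hq, hc, if_pos (by omega), show n - i = (i + 1) * q by omega,
      coeff_mul_expMonomial i.succ_pos, coeff_mul_expMonomial i.succ_pos, ← hf]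
    ring
  · rw [coeff_expMonomial_of_not_dvd h, zero_mul]
    split_ifs with hi
    · rw [coeff_expMonomial_of_not_dvd, mul_zero]
      intro hd
      apply h
      rw [show n + 1 = (n - i) + (i + 1) by omega]
      exact dvd_add hd dvd_rfl
    · simp

/-- The power series `exp (∑_{1 ≤ j ≤ N} t_j X ^ j)`, as a product of exponentials of monomials. -/
noncomputable def expSum (t : ℕ → R) (N : ℕ) : PowerSeries R :=
  ∏ i ∈ Finset.range N, expMonomial (i + 1) (t (i + 1))

theorem derivative_expSum (t : ℕ → R) (N : ℕ) :
    derivative R (expSum t N) =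
      expSum t N * ∑ i ∈ Finset.range N, C (((i : R) + 1) * t (i + 1)) * X ^ i := by
  induction N with
  | zero => simp [expSum]
  | succ N ih =>
    have hs : expSum t (N + 1) = expSum t N * expMonomial (N + 1) (t (N + 1)) :=
      Finset.prod_range_succ _ _
    rw [hs, Derivation.leibniz, ih, derivative_expMonomial, Finset.sum_range_succ,
      smul_eq_mul, smul_eq_mul]
    ring

theorem coeff_expSum_succ_of_le (t : ℕ → R) {k N : ℕ} (h : k ≤ N) :
    coeff k (expSum t (N + 1)) = coeff k (expSum t N) := by
  rw [expSum, Finset.prod_range_succ, ← expSum, coeff_mul,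
    Finset.sum_eq_single (k, 0)]
  · simp [coeff_expMonomial]
  · rintro ⟨a, b⟩ hab hne
    rw [Finset.HasAntidiagonal.mem_antidiagonal] at hab
    dsimp only at hab ⊢
    rw [coeff_expMonomial_of_not_dvd, mul_zero]
    intro hd
    obtain rfl | hb := Nat.eq_zero_or_pos b
    · exact hne (by simpa using hab)
    · have := Nat.le_of_dvd hb hd
      omega
  · simp

theorem coeff_expSum_of_le (t : ℕ → R) {k N : ℕ} (h : k ≤ N) :
    coeff k (expSum t N) = coeff k (expSum t k) := by
  induction N, h using Nat.le_induction with
  | base => rfl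
  | succ N h ih => rw [coeff_expSum_succ_of_le t h, ih]

theorem schurH_eq_coeff_expSum_self (t : ℕ → R) (k : ℕ) :
    schurH R k t = coeff k (expSum t k) := by
  classical
  rw [expSum, Finset.prod_range, coeff_prod, schurH]
  refine Finset.sum_of_injOn
    (fun m => Finsupp.equivFunOnFinite.symm fun i : Fin k => ((i : ℕ) + 1) * m i) ?_ ?_ ?_ ?_
  · intro m _ m' _ h
    funext i
    simpa using DFunLike.congr_fun h i
  · intro m hm
    simp only [Finset.coe_filter, Set.mem_ofPred_eq] at hm
    simp [Finset.mem_finsuppAntidiag, hm.2]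
  · intro l hl hnot
    rw [Finset.mem_finsuppAntidiag] at hl
    by_contra hne
    have hd : ∀ i : Fin k, (i : ℕ) + 1 ∣ l i := fun i => by
      by_contra hi
      exact hne (Finset.prod_eq_zero (Finset.mem_univ i) (coeff_expMonomial_of_not_dvd hi _))
    choose m hm using hd
    refine hnot ⟨m, ?_, ?_⟩
    · have hsum : ∑ i : Fin k, ((i : ℕ) + 1) * m i = k := by
        rw [← Finset.sum_congr rfl fun i _ => hm i]
        exact hl.1
      simp only [Finset.coe_filter, Set.mem_ofPred_eq, Fintype.mem_piFinset, Finset.mem_range]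
      refine ⟨fun i => ?_, hsum⟩
      have h1 : ((i : ℕ) + 1) * m i ≤ k :=
        (Finset.single_le_sum (f := fun i : Fin k => ((i : ℕ) + 1) * m i)
          (fun _ _ => Nat.zero_le _) (Finset.mem_univ i)).trans_eq hsum
      nlinarith [Nat.zero_le ((i : ℕ) * m i)]
    · ext i
      simp [hm i]
  · intro m _
    refine Finset.prod_congr rfl fun i _ => ?_
    simp [coeff_mul_expMonomial]

end PowerSeries

section Recurrence

variable {R : Type*} [CommRing R] [Algebra ℚ R]

theorem schurH_eq_coeff_expSum (t : ℕ → R) {k N : ℕ} (h : k ≤ N) :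
    schurH R k t = PowerSeries.coeff k (PowerSeries.expSum t N) := by
  rw [PowerSeries.coeff_expSum_of_le t h, PowerSeries.schurH_eq_coeff_expSum_self]

theorem schurH_zero (t : ℕ → R) : schurH R 0 t = 1 := by
  simp [schurH]

/-- Comparing coefficients in the logarithmic derivative of the generating function. -/
theorem succ_mul_schurH_succ (t : ℕ → R) (k : ℕ) :
    ((k : R) + 1) * schurH R (k + 1) t =
      ∑ i ∈ Finset.range (k + 1), ((i : R) + 1) * t (i + 1) * schurH R (k - i) t := by
  have h := congrArg (PowerSeries.coeff k) (PowerSeries.derivative_expSum t (k + 1))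
  rw [PowerSeries.coeff_derivative, Finset.mul_sum, map_sum] at h
  rw [schurH_eq_coeff_expSum t le_rfl, mul_comm, h]
  refine Finset.sum_congr rfl fun i hi => ?_
  rw [Finset.mem_range] at hi
  rw [mul_left_comm, PowerSeries.coeff_C_mul, PowerSeries.coeff_mul_X_pow',
    if_pos (by omega), schurH_eq_coeff_expSum t (show k - i ≤ k + 1 by omega)]

theorem schurH_succ_sub_geometric (t : ℕ → R) (u : R) (k : ℕ) :
    schurH R (k + 1) (fun j => t j - algebraMap ℚ R ((j : ℚ)⁻¹) * u ^ j) =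
      schurH R (k + 1) t - u * schurH R k t := by
  induction k using Nat.strong_induction_on with
  | _ k ih =>
    set s : ℕ → R := fun j => t j - algebraMap ℚ R ((j : ℚ)⁻¹) * u ^ j with hs
    have hcoef (i : ℕ) : ((i : R) + 1) * s (i + 1) = ((i : R) + 1) * t (i + 1) - u ^ (i + 1) := by
      have h1 : ((i : R) + 1) * algebraMap ℚ R (((i + 1 : ℕ) : ℚ)⁻¹) = 1 := by
        rw [show (i : R) + 1 = algebraMap ℚ R ((i + 1 : ℕ) : ℚ) by simp, ← map_mul,
          mul_inv_cancel₀ (by positivity), map_one]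
      rw [hs]
      linear_combination (-u ^ (i + 1)) * h1
    have hunit : IsUnit ((k : R) + 1) := by
      rw [show (k : R) + 1 = algebraMap ℚ R ((k : ℚ) + 1) by simp]
      exact (IsUnit.mk0 _ (by positivity)).map _
    have hk : (k : R) * schurH R k t =
        ∑ i ∈ Finset.range k, ((i : R) + 1) * t (i + 1) * schurH R (k - 1 - i) t := by
      obtain _ | k := k
      · simp
      · simpa using succ_mul_schurH_succ t k
    have htel : ∑ i ∈ Finset.range k, u ^ (i + 1) *
        (schurH R (k - i) t - u * schurH R (k - 1 - i) t) + u ^ (k + 1) = u * schurH R k t := by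
      have h := Finset.sum_range_sub' (fun i => u ^ (i + 1) * schurH R (k - i) t) k
      simp only [Nat.sub_self, schurH_zero, Nat.sub_zero, zero_add, pow_one, mul_one] at h
      rw [← eq_sub_iff_add_eq, ← h]
      refine Finset.sum_congr rfl fun i _ => ?_
      rw [Nat.sub_sub, add_comm 1 i]
      ring
    have hstep : ∑ i ∈ Finset.range k, ((i : R) + 1) * s (i + 1) * schurH R (k - i) s =
        ∑ i ∈ Finset.range k, (((i : R) + 1) * t (i + 1) * schurH R (k - i) t -
          u * (((i : R) + 1) * t (i + 1) * schurH R (k - 1 - i) t) -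
          u ^ (i + 1) * (schurH R (k - i) t - u * schurH R (k - 1 - i) t)) := by
      refine Finset.sum_congr rfl fun i hi => ?_
      rw [Finset.mem_range] at hi
      have h := ih (k - 1 - i) (by omega)
      rw [show k - 1 - i + 1 = k - i by omega] at h
      rw [hcoef, h]
      ring
    have ht := succ_mul_schurH_succ t k
    apply hunit.mul_left_cancel
    rw [succ_mul_schurH_succ, Finset.sum_range_succ, hstep, Finset.sum_sub_distrib,
      Finset.sum_sub_distrib, ← Finset.mul_sum, ← hk, Nat.sub_self, schurH_zero, hcoef]
    rw [Finset.sum_range_succ, Nat.sub_self, schurH_zero] at ht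
    linear_combination -ht - htel

end Recurrence

/-- `h_n(t − [z⁻¹]) = h_n(t) − z⁻¹ h_{n−1}(t)`: subtracting the Miwa variables of
`z⁻¹` from the arguments of the elementary Schur polynomial. -/
theorem schurH_sub_miwa {R : Type*} [CommRing R] [Algebra ℚ R]
    (n : ℕ) (hn : 1 ≤ n) (t : ℕ → R) (z : Rˣ) :
    schurH R n (fun j => t j - algebraMap ℚ R ((j : ℚ)⁻¹) * ((z⁻¹ : Rˣ) : R) ^ j) =
      schurH R n t - ((z⁻¹ : Rˣ) : R) * schurH R (n - 1) t := by
  obtain _ | k := n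
  · omega
  · exact schurH_succ_sub_geometric t _ k
end
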